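/- Let α ∈ (1,2), D ⊂ R^d bounded Lipschitz, and suppose g ∈ C^2(R^d) vanishes outside D with |∇^2 g(x)| ≤ M ( dist(x,∂D)^{-2+α/2} 1_{{dist(x,∂D) > 3ε}}(x) + ε^{-2+α/2} 1_{{dist(x,∂D) ≤ 3ε}}(x) ) and |∇^3 g(x)| ≤ M ( dist(x,∂D)^{-3+α/2} 1_{{dist(x,∂D) > 3ε}}(x) + ε^{-3+α/2} 1_{{dist(x,∂D) ≤ 3ε}}(x) ). Then for the operator A h(x) = ∫ (h(x+z) - h(x) - ⟨∇h(x), z⟩) k(x,z) |z|^{-(d+α)} dz with measurable k satisfying 0 ≤ k ≤ Λ, it holds |A(∇g)(x)| ≤ C ( ε^{1-α} dist(x,∂D)^{-2+α/2} + ε^{-1+α/2} dist(x,∂D)^{-α} ) for x with dist(x,∂D) > 4ε, and |A(∇g)(x)| ≤ C ε^{-1-α/2} for x ∈ D with dist(x,∂D) ≤ 4ε, with C independent of ε. -/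

import Mathlib

noncomputable section
open MeasureTheory Metric Set Filter Topology

/-- A bounded Lipschitz domain in `ℝ^d`, encoded via openness, boundedness and the
uniform interior cone condition (which characterizes Lipschitz domains among
bounded open sets). -/
def IsBoundedLipschitzDomain {d : ℕ} (D : Set (EuclideanSpace ℝ (Fin d))) : Prop :=
  IsOpen D ∧ Bornology.IsBounded D ∧
    ∃ r h : ℝ, 0 < r ∧ 0 < h ∧
      ∀ p ∈ frontier D, ∃ v : EuclideanSpace ℝ (Fin d), ‖v‖ = 1 ∧
        ∀ x ∈ Metric.ball p r ∩ closure D, ∀ t ∈ Set.Ioc (0 : ℝ) h,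
          ∀ y ∈ Metric.ball (x + t • v) (r * t), y ∈ D

section RadialIntegrals

variable {E : Type*} [NormedAddCommGroup E] [NormedSpace ℝ E] [MeasurableSpace E]

/-- The surface measure of the unit sphere, as the constant in polar integration. -/
def radialMass (μ : Measure E) : ℝ := Module.finrank ℝ E * μ.real (ball 0 1)

lemma radialMass_nonneg (μ : Measure E) : 0 ≤ radialMass μ := by
  unfold radialMass; positivity

variable [FiniteDimensional ℝ E] [Nontrivial E] [BorelSpace E]

lemma integrable_and_integral_indicator_norm_rpow (μ : Measure E) [μ.IsAddHaarMeasure]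
    {p : ℝ} {S : Set ℝ} (hS : MeasurableSet S)
    (hint : IntegrableOn (fun y : ℝ => y ^ (p - 1)) (Ioi 0 ∩ S)) :
    Integrable (fun z : E => S.indicator (fun r => r ^ (p - Module.finrank ℝ E)) ‖z‖) μ ∧
      ∫ z : E, S.indicator (fun r => r ^ (p - Module.finrank ℝ E)) ‖z‖ ∂μ
        = radialMass μ * ∫ y in Ioi 0 ∩ S, y ^ (p - 1) := by
  have hn : 1 ≤ Module.finrank ℝ E := Module.finrank_pos
  have key : EqOn (fun y : ℝ => y ^ (Module.finrank ℝ E - 1) •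
      S.indicator (fun r => r ^ (p - Module.finrank ℝ E)) y)
      (S.indicator fun y => y ^ (p - 1)) (Ioi 0) := by
    intro y hy
    by_cases hyS : y ∈ S
    · simp only [indicator_of_mem hyS, smul_eq_mul]
      rw [← Real.rpow_natCast, ← Real.rpow_add hy, Nat.cast_sub hn]
      congr 1; push_cast; ring
    · simp [indicator_of_notMem hyS]
  constructor
  · rw [integrable_fun_norm_addHaar μ, integrableOn_congr_fun key measurableSet_Ioi,
      IntegrableOn, integrable_indicator_iff hS, IntegrableOn, Measure.restrict_restrict hS,
      inter_comm]
    exact hint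
  · rw [integral_fun_norm_addHaar μ, setIntegral_congr_fun measurableSet_Ioi key,
      setIntegral_indicator hS, radialMass, nsmul_eq_mul, smul_eq_mul, mul_assoc]

lemma integrable_and_integral_near_norm_rpow (μ : Measure E) [μ.IsAddHaarMeasure]
    {p ρ : ℝ} (hp : 0 < p) (hρ : 0 < ρ) :
    Integrable (fun z : E => (Iio ρ).indicator (fun r => r ^ (p - Module.finrank ℝ E)) ‖z‖) μ ∧
      ∫ z : E, (Iio ρ).indicator (fun r => r ^ (p - Module.finrank ℝ E)) ‖z‖ ∂μ
        = radialMass μ * (ρ ^ p / p) := by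
  have hint : IntegrableOn (fun y : ℝ => y ^ (p - 1)) (Ioi 0 ∩ Iio ρ) :=
    (intervalIntegral.integrableOn_Ioo_rpow_iff hρ).2 (by linarith)
  have h := integrable_and_integral_indicator_norm_rpow μ measurableSet_Iio hint
  refine ⟨h.1, h.2.trans ?_⟩
  rw [Ioi_inter_Iio, ← integral_Ioc_eq_integral_Ioo, ← intervalIntegral.integral_of_le hρ.le,
    integral_rpow (Or.inl (by linarith)), sub_add_cancel, Real.zero_rpow hp.ne', sub_zero]

lemma integrable_and_integral_far_norm_rpow (μ : Measure E) [μ.IsAddHaarMeasure]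
    {p ρ : ℝ} (hp : 0 < p) (hρ : 0 < ρ) :
    Integrable (fun z : E => (Ici ρ).indicator (fun r => r ^ (-p - Module.finrank ℝ E)) ‖z‖) μ ∧
      ∫ z : E, (Ici ρ).indicator (fun r => r ^ (-p - Module.finrank ℝ E)) ‖z‖ ∂μ
        = radialMass μ * (ρ ^ (-p) / p) := by
  have hset : Ioi 0 ∩ Ici ρ = Ici ρ := inter_eq_right.2 fun y hy => hρ.trans_le hy
  have hint : IntegrableOn (fun y : ℝ => y ^ (-p - 1)) (Ioi 0 ∩ Ici ρ) := by
    rw [hset, integrableOn_Ici_iff_integrableOn_Ioi]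
    exact integrableOn_Ioi_rpow_of_lt (by linarith) hρ
  have h := integrable_and_integral_indicator_norm_rpow μ measurableSet_Ici hint
  refine ⟨h.1, h.2.trans ?_⟩
  rw [hset, integral_Ici_eq_integral_Ioi, integral_Ioi_rpow_of_lt (by linarith) hρ,
    sub_add_cancel, neg_div_neg_eq]

/-- Bound for a singular integral with quadratic cancellation near the origin and linear growth
far from it. -/
lemma abs_integral_mul_rpow_norm_le (μ : Measure E) [μ.IsAddHaarMeasure]
    {α Λ ρ a b c : ℝ} (hα : α ∈ Ioo (1 : ℝ) 2) (hρ : 0 < ρ)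
    (ha : 0 ≤ a) {F κ : E → ℝ}
    (hκ : ∀ z, 0 ≤ κ z ∧ κ z ≤ Λ)
    (hnear : ∀ z, ‖z‖ < ρ → |F z| ≤ a * ‖z‖ ^ 2)
    (hfar : ∀ z, ρ ≤ ‖z‖ → |F z| ≤ b * ‖z‖ + c) :
    |∫ z, F z * κ z * ‖z‖ ^ (-((Module.finrank ℝ E : ℝ) + α)) ∂μ|
      ≤ Λ * radialMass μ *
        (a * (ρ ^ (2 - α) / (2 - α)) + b * (ρ ^ (-(α - 1)) / (α - 1)) + c * (ρ ^ (-α) / α)) := by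
  obtain ⟨hα1, hα2⟩ := hα
  obtain ⟨i1, e1⟩ := integrable_and_integral_near_norm_rpow μ (sub_pos.2 hα2) hρ
  obtain ⟨i2, e2⟩ := integrable_and_integral_far_norm_rpow μ (sub_pos.2 hα1) hρ
  obtain ⟨i3, e3⟩ := integrable_and_integral_far_norm_rpow μ (zero_lt_one.trans hα1) hρ
  have hΛ : 0 ≤ Λ := (hκ 0).1.trans (hκ 0).2
  have hI := ((i1.const_mul a).add (i2.const_mul b)).add (i3.const_mul c) |>.const_mul Λ
  rw [← Real.norm_eq_abs]
  refine (norm_integral_le_of_norm_le hI (Eventually.of_forall fun z => ?_)).trans_eq ?_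
  · have hw : 0 ≤ ‖z‖ ^ (-((Module.finrank ℝ E : ℝ) + α)) := by positivity
    have hmul : ‖F z * κ z * ‖z‖ ^ (-((Module.finrank ℝ E : ℝ) + α))‖
        ≤ Λ * (|F z| * ‖z‖ ^ (-((Module.finrank ℝ E : ℝ) + α))) := by
      rw [norm_mul, norm_mul, Real.norm_eq_abs, Real.norm_eq_abs, Real.norm_eq_abs,
        abs_of_nonneg hw, abs_of_nonneg (hκ z).1, mul_comm |F z|, mul_assoc]
      exact mul_le_mul_of_nonneg_right (hκ z).2 (by positivity)
    refine hmul.trans (mul_le_mul_of_nonneg_left ?_ hΛ)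
    simp only [Pi.add_apply]
    rcases lt_or_ge ‖z‖ ρ with hz | hz
    · have h1 : ‖z‖ ∈ Iio ρ := hz
      have h2 : ‖z‖ ∉ Ici ρ := not_le.2 hz
      rw [indicator_of_mem h1, indicator_of_notMem h2, indicator_of_notMem h2, mul_zero, mul_zero,
        add_zero, add_zero]
      rcases eq_or_ne z 0 with rfl | hz0
      · have : F 0 = 0 := by simpa using hnear 0 hz
        rw [this, abs_zero, zero_mul]
        positivity
      · refine (mul_le_mul_of_nonneg_right (hnear z hz) hw).trans_eq ?_
        rw [mul_assoc, ← Real.rpow_natCast, ← Real.rpow_add (norm_pos_iff.2 hz0)]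
        congr 2; push_cast; ring
    · have h1 : ‖z‖ ∉ Iio ρ := not_lt.2 hz
      have h2 : ‖z‖ ∈ Ici ρ := hz
      rw [indicator_of_notMem h1, indicator_of_mem h2, indicator_of_mem h2, mul_zero, zero_add]
      refine (mul_le_mul_of_nonneg_right (hfar z hz) hw).trans_eq ?_
      rw [add_mul, mul_assoc]
      congr 2
      · rw [← Real.rpow_one_add' (norm_nonneg z)]
        · congr 1; ring
        · have : (0 : ℝ) ≤ Module.finrank ℝ E := by positivity
          linarith
      · congr 1; ring
  · rw [integral_const_mul, integral_add' ((i1.const_mul a).add (i2.const_mul b)) (i3.const_mul c),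
      integral_add' (i1.const_mul a) (i2.const_mul b), integral_const_mul, integral_const_mul,
      integral_const_mul, e1, e2, e3]
    ring

end RadialIntegrals

section Derivatives

variable {E : Type*} [NormedAddCommGroup E] [NormedSpace ℝ E]

lemma contDiff_fderiv_apply {g : E → ℝ} (hg : ContDiff ℝ 3 g) (v : E) :
    ContDiff ℝ 2 (fun y => fderiv ℝ g y v) :=
  (hg.fderiv_right (m := 2) (by norm_num)).clm_apply contDiff_const

lemma norm_iteratedFDeriv_fderiv_apply_le {g : E → ℝ} (hg : ContDiff ℝ 3 g) {v : E}
    (hv : ‖v‖ ≤ 1) {n : ℕ} (hn : n ≤ 2) (y : E) :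
    ‖iteratedFDeriv ℝ n (fun y => fderiv ℝ g y v) y‖ ≤ ‖iteratedFDeriv ℝ (n + 1) g y‖ := by
  have hc : ContDiff ℝ 2 (fderiv ℝ g) := hg.fderiv_right (m := 2) (by norm_num)
  have h := (ContinuousLinearMap.apply ℝ ℝ v).norm_iteratedFDeriv_comp_left
    (hc.contDiffAt (x := y)) (n := n) (by exact_mod_cast hn)
  rw [norm_iteratedFDeriv_fderiv] at h
  refine h.trans (mul_le_of_le_one_left (norm_nonneg _) ?_)
  refine ContinuousLinearMap.opNorm_le_bound _ zero_le_one fun L => ?_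
  rw [one_mul, ContinuousLinearMap.apply_apply]
  exact L.le_of_opNorm_le_of_le le_rfl hv |>.trans_eq (mul_one _)

lemma norm_fderiv_fderiv_apply_le {g : E → ℝ} (hg : ContDiff ℝ 3 g) {v : E}
    (hv : ‖v‖ ≤ 1) (y : E) :
    ‖fderiv ℝ (fun y => fderiv ℝ g y v) y‖ ≤ ‖iteratedFDeriv ℝ 2 g y‖ := by
  rw [← norm_iteratedFDeriv_one]
  exact norm_iteratedFDeriv_fderiv_apply_le hg hv one_le_two y

lemma norm_fderiv_fderiv_fderiv_apply_le {g : E → ℝ} (hg : ContDiff ℝ 3 g) {v : E}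
    (hv : ‖v‖ ≤ 1) (y : E) :
    ‖fderiv ℝ (fderiv ℝ (fun y => fderiv ℝ g y v)) y‖ ≤ ‖iteratedFDeriv ℝ 3 g y‖ := by
  rw [← norm_iteratedFDeriv_one, norm_iteratedFDeriv_fderiv]
  exact norm_iteratedFDeriv_fderiv_apply_le hg hv le_rfl y

lemma norm_taylor_one_remainder_le {h : E → ℝ} (hh : ContDiff ℝ 2 h) {x : E} {ρ a : ℝ}
    (ha : ∀ y ∈ ball x ρ, ‖fderiv ℝ (fderiv ℝ h) y‖ ≤ a) {z : E} (hz : ‖z‖ < ρ) :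
    |h (x + z) - h x - fderiv ℝ h x z| ≤ a * ‖z‖ ^ 2 := by
  have hd : Differentiable ℝ h := hh.differentiable (by norm_num)
  have hd' : Differentiable ℝ (fderiv ℝ h) :=
    (hh.fderiv_right (m := 1) (by norm_num)).differentiable (by norm_num)
  have hsub : closedBall x ‖z‖ ⊆ ball x ρ := closedBall_subset_ball hz
  have hx : x ∈ closedBall x ‖z‖ := mem_closedBall_self (norm_nonneg z)
  have ha0 : 0 ≤ a := (norm_nonneg (fderiv ℝ (fderiv ℝ h) x)).trans (ha x (hsub hx))
  have hconv : Convex ℝ (closedBall x ‖z‖) := convex_closedBall x ‖z‖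
  have hb : ∀ y ∈ closedBall x ‖z‖, ‖fderiv ℝ h y - fderiv ℝ h x‖ ≤ a * ‖z‖ := fun y hy =>
    (hconv.norm_image_sub_le_of_norm_fderiv_le (fun w _ => hd' w)
      (fun w hw => ha w (hsub hw)) hx hy).trans
      (mul_le_mul_of_nonneg_left (by rwa [← dist_eq_norm]) ha0)
  have := hconv.norm_image_sub_le_of_norm_hasFDerivWithin_le' (φ := fderiv ℝ h x)
    (fun y _ => (hd y).hasFDerivAt.hasFDerivWithinAt) hb hx (y := x + z) (by simp)
  rw [add_sub_cancel_left, Real.norm_eq_abs] at this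
  exact this.trans_eq (by ring)

end Derivatives

lemma indicator_weight_le {E : Type*} [PseudoMetricSpace E] {S : Set E} {ε w e : ℝ} {x : E} (hε : 0 < ε) (hw : 0 < w)
    (hwx : w ≤ max (infDist x S / 3) ε) (he : e ≤ 0) :
    Set.indicator {y : E | 3 * ε < infDist y S} (fun _ => infDist x S ^ e) x
      + Set.indicator {y : E | infDist y S ≤ 3 * ε} (fun _ => ε ^ e) x ≤ w ^ e := by
  rcases lt_or_ge (3 * ε) (infDist x S) with h | h
  · rw [indicator_of_mem (by exact h), indicator_of_notMem (by exact not_le.2 h), add_zero]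
    rw [max_eq_left (by linarith)] at hwx
    exact Real.rpow_le_rpow_of_nonpos hw (by linarith) he
  · rw [indicator_of_notMem (by exact not_lt.2 h), indicator_of_mem (by exact h), zero_add]
    rw [max_eq_right (by linarith)] at hwx
    exact Real.rpow_le_rpow_of_nonpos hw hwx he

section Domain

variable {E : Type*} [NormedAddCommGroup E] [NormedSpace ℝ E]

lemma ball_infDist_frontier_subset {D : Set E} (hD : IsOpen D) {y : E} (hy : y ∈ D) :
    ball y (infDist y (frontier D)) ⊆ D := by
  rcases (infDist_nonneg (x := y) (s := frontier D)).eq_or_lt with h0 | h0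
  · simp [← h0]
  have hcov : ball y (infDist y (frontier D)) ⊆ D ∪ (closure D)ᶜ := fun w hw => by
    by_contra hcon
    rw [mem_union, not_or, notMem_compl_iff] at hcon
    have hwf : w ∈ frontier D := hD.frontier_eq ▸ ⟨hcon.2, hcon.1⟩
    exact (infDist_le_dist_of_mem hwf).not_gt (by rwa [dist_comm])
  have hdisj : D ∩ (closure D)ᶜ = ∅ :=
    (disjoint_compl_right.mono_left subset_closure).inter_eq
  rcases isPreconnected_iff_subset_of_disjoint.1
    (convex_ball y (infDist y (frontier D))).isPreconnected D (closure D)ᶜ hD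
    isClosed_closure.isOpen_compl hcov (by rw [hdisj, inter_empty]) with h | h
  · exact h
  · exact absurd (subset_closure hy) (h (mem_ball_self h0))

lemma IsBoundedLipschitzDomain.frontier_subset_closure_exterior {d : ℕ}
    {D : Set (EuclideanSpace ℝ (Fin d))} (hD : IsBoundedLipschitzDomain D) :
    frontier D ⊆ closure (closure D)ᶜ := by
  obtain ⟨hopen, -, r, h, hr, hh, hcone⟩ := hD
  intro p hp
  obtain ⟨v, hv, hcone⟩ := hcone p hp
  have hpD : p ∉ D := by
    rw [hopen.frontier_eq] at hp
    exact hp.2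
  have htend : Tendsto (fun t : ℝ => p - t • v) (𝓝[>] 0) (𝓝 p) := by
    have : Continuous fun t : ℝ => p - t • v := by fun_prop
    simpa using (this.tendsto 0).mono_left nhdsWithin_le_nhds
  refine mem_closure_of_tendsto htend ?_
  filter_upwards [Ioo_mem_nhdsGT (lt_min hr hh)] with t ht hmem
  have ht0 : 0 < t := ht.1
  refine hpD (hcone (p - t • v) ⟨?_, hmem⟩ t ⟨ht0, (ht.2.trans_le (min_le_right _ _)).le⟩ p ?_)
  · rw [mem_ball, dist_eq_norm, sub_sub_cancel_left, norm_neg, norm_smul, hv, mul_one,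
      Real.norm_eq_abs, abs_of_pos ht0]
    exact ht.2.trans_le (min_le_left _ _)
  · rw [sub_add_cancel]
    exact mem_ball_self (by positivity)

lemma fderiv_eq_zero_of_mem_closure_exterior {g : E → ℝ} (hg : ContDiff ℝ 1 g) {D : Set E}
    (hgD : ∀ x ∉ D, g x = 0) {p : E} (hp : p ∈ closure (closure D)ᶜ) : fderiv ℝ g p = 0 := by
  have hsupp : tsupport g ⊆ closure D :=
    closure_mono (Function.support_subset_iff'.2 hgD)
  have hclosed : IsClosed {x | fderiv ℝ g x = 0} :=
    isClosed_eq (hg.continuous_fderiv (by norm_num)) continuous_const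
  refine closure_minimal (fun x hx => ?_) hclosed hp
  exact Function.notMem_support.1 fun hs => hx (hsupp (support_fderiv_subset ℝ hs))

lemma norm_iteratedFDeriv_le_of_forall_mem {g : E → ℝ} {n : ℕ} (hg : ContDiff ℝ n g) {D : Set E}
    (hgD : ∀ x ∉ D, g x = 0) {B : ℝ} (hB : 0 ≤ B)
    (hb : ∀ x ∈ D, ‖iteratedFDeriv ℝ n g x‖ ≤ B) (x : E) : ‖iteratedFDeriv ℝ n g x‖ ≤ B := by
  by_cases hx : x ∈ closure D
  · have hclosed : IsClosed {x | ‖iteratedFDeriv ℝ n g x‖ ≤ B} :=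
      isClosed_le (hg.continuous_iteratedFDeriv le_rfl).norm continuous_const
    exact closure_minimal hb hclosed hx
  · have hsupp : tsupport g ⊆ closure D :=
      closure_mono (Function.support_subset_iff'.2 hgD)
    have : iteratedFDeriv ℝ n g x = 0 :=
      Function.notMem_support.1 fun hs => hx (hsupp (support_iteratedFDeriv_subset n hs))
    rwa [this, norm_zero]

/-- A function vanishing on the boundary, whose gradient is controlled by a negative power of the
regularized distance to the boundary, is bounded. -/
lemma abs_le_of_norm_fderiv_le_rpow [ProperSpace E] {D : Set E} (hD : IsOpen D)
    (hne : (frontier D).Nonempty) {h : E → ℝ} (hh : Differentiable ℝ h)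
    (h0 : ∀ p ∈ frontier D, h p = 0 ∧ fderiv ℝ h p = 0) {ε M e : ℝ} (hε : 0 < ε) (hM : 0 ≤ M)
    (he : e ∈ Ioo (-2 : ℝ) (-1))
    (hb : ∀ y ∈ D, ∀ w, 0 < w → w ≤ max (infDist y (frontier D) / 3) ε →
      ‖fderiv ℝ h y‖ ≤ M * w ^ e)
    {y : E} (hy : y ∈ D) : |h y| ≤ 16 * M / (-(e + 1)) * ε ^ (e + 1) := by
  obtain ⟨he2, he1⟩ := he
  have hc : 0 < -(e + 1) := by linarith
  obtain ⟨p, hp, hdist⟩ := isClosed_frontier.exists_infDist_eq_dist hne y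
  have hyp : y ≠ p := by
    rintro rfl
    rw [hD.frontier_eq] at hp
    exact hp.2 hy
  set δ := dist y p with hδ
  have hδ0 : 0 < δ := dist_pos.2 hyp
  set u := δ⁻¹ • (y - p) with hu
  have hδu : δ • u = y - p := by rw [hu, smul_smul, mul_inv_cancel₀ hδ0.ne', one_smul]
  have hunorm : ‖u‖ = 1 := by
    rw [hu, norm_smul, norm_inv, Real.norm_of_nonneg hδ0.le, ← dist_eq_norm, ← hδ,
      inv_mul_cancel₀ hδ0.ne']
  have hdisty : ∀ s ∈ Ico 0 δ, dist (p + s • u) y = δ - s := fun s hs => by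
    have : p + s • u - y = (s - δ) • u := by rw [sub_smul, hδu]; abel
    rw [dist_eq_norm, this, norm_smul, hunorm, mul_one, Real.norm_eq_abs, abs_sub_comm,
      abs_of_pos (sub_pos.2 hs.2)]
  have hder : ∀ s : ℝ, HasDerivAt (fun s : ℝ => h (p + s • u)) (fderiv ℝ h (p + s • u) u) s := by
    intro s
    have hl : HasDerivAt (fun s : ℝ => p + s • u) u s := by
      simpa using ((hasDerivAt_id s).smul_const u).const_add p
    exact (hh _).hasFDerivAt.comp_hasDerivAt s hl
  have hBder : ∀ s ∈ Icc 0 δ, HasDerivAt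
      (fun s : ℝ => 4 * M / (-(e + 1)) * ((ε / 4) ^ (e + 1) - ((s + ε) / 4) ^ (e + 1)))
      (M * ((s + ε) / 4) ^ e) s := by
    intro s hs
    have hpos : (s + ε) / 4 ≠ 0 := by have := hs.1; positivity
    have h1 : HasDerivAt (fun s : ℝ => (s + ε) / 4) (1 / 4) s :=
      ((hasDerivAt_id s).add_const ε).div_const 4
    refine (((h1.rpow_const (p := e + 1) (Or.inl hpos)).const_sub ((ε / 4) ^ (e + 1))).const_mul
      (4 * M / (-(e + 1)))).congr_deriv ?_
    rw [add_sub_cancel_right]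
    have : e + 1 ≠ 0 := by linarith
    field_simp
  have hbd : ∀ s ∈ Ico 0 δ, ‖fderiv ℝ h (p + s • u) u‖ ≤ M * ((s + ε) / 4) ^ e := by
    intro s hs
    have hs0 : 0 ≤ s := hs.1
    rcases hs0.eq_or_lt with rfl | hspos
    · rw [zero_smul, add_zero, (h0 p hp).2, zero_apply, norm_zero]
      positivity
    have hmem : p + s • u ∈ D := ball_infDist_frontier_subset hD hy (by
      rw [mem_ball, hdisty s hs, hdist]; linarith)
    have hinf : s ≤ infDist (p + s • u) (frontier D) := by
      have := infDist_le_infDist_add_dist (s := frontier D) (x := y) (y := p + s • u)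
      rw [dist_comm, hdisty s hs, hdist] at this
      linarith
    refine (ContinuousLinearMap.le_of_opNorm_le_of_le _ (hb _ hmem ((s + ε) / 4) (by positivity) ?_)
      hunorm.le).trans_eq (mul_one _)
    rcases le_total ε (infDist (p + s • u) (frontier D) / 3) with h3 | h3
    · exact le_max_of_le_left (by linarith)
    · exact le_max_of_le_right (by linarith)
  have hmain := image_norm_le_of_norm_deriv_right_le_deriv_boundary'
    (fun s _ => (hder s).continuousAt.continuousWithinAt)
    (fun s _ => (hder s).hasDerivWithinAt) (by simp [(h0 p hp).1])
    (fun s hs => (hBder s hs).continuousAt.continuousWithinAt)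
    (fun s hs => (hBder s (Ico_subset_Icc_self hs)).hasDerivWithinAt) hbd
    (right_mem_Icc.2 hδ0.le)
  rw [hδu, add_sub_cancel, Real.norm_eq_abs] at hmain
  refine hmain.trans ?_
  have hε4 : (ε / 4) ^ (e + 1) ≤ 4 * ε ^ (e + 1) := by
    have h4 : (4 : ℝ) ^ (-(e + 1)) ≤ 4 ^ (1 : ℝ) :=
      Real.rpow_le_rpow_of_exponent_le (by norm_num) (by linarith)
    rw [Real.div_rpow hε.le (by norm_num), div_eq_mul_inv, ← Real.rpow_neg (by norm_num), mul_comm]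
    rw [Real.rpow_one] at h4
    exact mul_le_mul_of_nonneg_right h4 (by positivity)
  have hpos : 0 ≤ ((δ + ε) / 4) ^ (e + 1) := by positivity
  calc _ ≤ 4 * M / (-(e + 1)) * (4 * ε ^ (e + 1)) :=
        mul_le_mul_of_nonneg_left (by linarith) (by positivity)
    _ = _ := by ring

end Domain

theorem stmt_14 {d : ℕ} (hd : 0 < d) {D : Set (EuclideanSpace ℝ (Fin d))}
    (hD : IsBoundedLipschitzDomain D) {α : ℝ} (hα : α ∈ Set.Ioo (1 : ℝ) 2)
    {Λ : ℝ} (hΛ : 0 < Λ) (M : ℝ) (hM : 0 ≤ M) :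
    ∃ C : ℝ, 0 < C ∧
      ∀ ε ∈ Set.Ioo (0 : ℝ) 1,
      ∀ g : EuclideanSpace ℝ (Fin d) → ℝ,
        ContDiff ℝ 3 g → (∀ x ∉ D, g x = 0) →
        (∀ x ∈ D, ‖iteratedFDeriv ℝ 2 g x‖
          ≤ M * (Set.indicator {y : EuclideanSpace ℝ (Fin d) |
                3 * ε < Metric.infDist y (frontier D)}
              (fun _ => Metric.infDist x (frontier D) ^ (-2 + α / 2)) x
            + Set.indicator {y : EuclideanSpace ℝ (Fin d) |
                Metric.infDist y (frontier D) ≤ 3 * ε}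
              (fun _ => ε ^ (-2 + α / 2)) x)) →
        (∀ x ∈ D, ‖iteratedFDeriv ℝ 3 g x‖
          ≤ M * (Set.indicator {y : EuclideanSpace ℝ (Fin d) |
                3 * ε < Metric.infDist y (frontier D)}
              (fun _ => Metric.infDist x (frontier D) ^ (-3 + α / 2)) x
            + Set.indicator {y : EuclideanSpace ℝ (Fin d) |
                Metric.infDist y (frontier D) ≤ 3 * ε}
              (fun _ => ε ^ (-3 + α / 2)) x)) →
      ∀ k : EuclideanSpace ℝ (Fin d) → EuclideanSpace ℝ (Fin d) → ℝ,
        Measurable (Function.uncurry k) → (∀ x z, 0 ≤ k x z ∧ k x z ≤ Λ) →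
      -- `A` is applied componentwise to `∇ g`, i.e. to every directional derivative
      -- `h = ⟨∇g, v⟩` with `‖v‖ ≤ 1`
      ∀ v : EuclideanSpace ℝ (Fin d), ‖v‖ ≤ 1 →
      ∀ x ∈ D,
        (4 * ε < Metric.infDist x (frontier D) →
          |∫ z : EuclideanSpace ℝ (Fin d),
              (fderiv ℝ g (x + z) v - fderiv ℝ g x v
                - fderiv ℝ (fun y => fderiv ℝ g y v) x z)
                * k x z * ‖z‖ ^ (-((d : ℝ) + α))|
            ≤ C * (ε ^ (1 - α) * Metric.infDist x (frontier D) ^ (-2 + α / 2)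
                + ε ^ (-1 + α / 2) * Metric.infDist x (frontier D) ^ (-α))) ∧
        (Metric.infDist x (frontier D) ≤ 4 * ε →
          |∫ z : EuclideanSpace ℝ (Fin d),
              (fderiv ℝ g (x + z) v - fderiv ℝ g x v
                - fderiv ℝ (fun y => fderiv ℝ g y v) x z)
                * k x z * ‖z‖ ^ (-((d : ℝ) + α))|
            ≤ C * ε ^ (-1 - α / 2)) := by
  have : Nonempty (Fin d) := ⟨⟨0, hd⟩⟩
  obtain ⟨hα1, hα2⟩ := id hα
  set m := radialMass (volume : Measure (EuclideanSpace ℝ (Fin d))) with hm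
  have hm0 : 0 ≤ m := radialMass_nonneg _
  have h2α : 0 < 2 - α := by linarith
  have hα1' : 0 < α - 1 := by linarith
  have hαh : 0 < 1 - α / 2 := by linarith
  have hα0 : 0 < α := by linarith
  refine ⟨Λ * m * M * (16 / (2 - α) + 16 / (α - 1) + 512 / ((1 - α / 2) * α)) + 1,
    by positivity, ?_⟩
  intro ε hεI g hg hgD hg2 hg3 k _ hk v hv x hx
  have hε : 0 < ε := hεI.1
  set F := frontier D with hF
  set h : EuclideanSpace ℝ (Fin d) → ℝ := fun y => fderiv ℝ g y v with hh
  have hhC : ContDiff ℝ 2 h := contDiff_fderiv_apply hg v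
  have hhd : Differentiable ℝ h := hhC.differentiable (by norm_num)
  -- weighted bounds inside the domain and uniform bounds everywhere
  have b2 : ∀ y ∈ D, ∀ w, 0 < w → w ≤ max (infDist y F / 3) ε →
      ‖iteratedFDeriv ℝ 2 g y‖ ≤ M * w ^ (-2 + α / 2) := fun y hy w hw hwy =>
    (hg2 y hy).trans
      (mul_le_mul_of_nonneg_left (indicator_weight_le hε hw hwy (by linarith)) hM)
  have b3 : ∀ y ∈ D, ∀ w, 0 < w → w ≤ max (infDist y F / 3) ε →
      ‖iteratedFDeriv ℝ 3 g y‖ ≤ M * w ^ (-3 + α / 2) := fun y hy w hw hwy =>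
    (hg3 y hy).trans
      (mul_le_mul_of_nonneg_left (indicator_weight_le hε hw hwy (by linarith)) hM)
  have G2 : ∀ y, ‖fderiv ℝ h y‖ ≤ M * ε ^ (-2 + α / 2) := fun y =>
    (norm_fderiv_fderiv_apply_le hg hv y).trans
      (norm_iteratedFDeriv_le_of_forall_mem (n := 2) (hg.of_le (by norm_num)) hgD (by positivity)
        (fun y hy => b2 y hy ε hε (le_max_right _ _)) y)
  have G3 : ∀ y, ‖fderiv ℝ (fderiv ℝ h) y‖ ≤ M * ε ^ (-3 + α / 2) := fun y =>
    (norm_fderiv_fderiv_fderiv_apply_le hg hv y).trans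
      (norm_iteratedFDeriv_le_of_forall_mem (n := 3) hg hgD (by positivity)
        (fun y hy => b3 y hy ε hε (le_max_right _ _)) y)
  have key := fun (ρ a b c : ℝ) (hρ : 0 < ρ) (ha : 0 ≤ a) =>
    abs_integral_mul_rpow_norm_le (volume : Measure (EuclideanSpace ℝ (Fin d)))
      (b := b) (c := c) (F := fun z => h (x + z) - h x - fderiv ℝ h x z) hα hρ ha (hk x)
  rw [finrank_euclideanSpace_fin, ← hm] at key
  constructor
  · intro hδ
    set δ := infDist x F with hδdef
    have hδ0 : 0 < δ := by linarith
    set ρ := δ / 4 with hρdef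
    have hρ : 0 < ρ := by positivity
    have hερ : ε ≤ ρ := by linarith
    have hne : F.Nonempty := by
      by_contra hcon
      rw [not_nonempty_iff_eq_empty] at hcon
      rw [hδdef, hcon, infDist_empty] at hδ0
      exact lt_irrefl _ hδ0
    have hg0 : ∀ p ∈ closure (closure D)ᶜ, fderiv ℝ g p = 0 := fun p hp =>
      fderiv_eq_zero_of_mem_closure_exterior (hg.of_le (by norm_num)) hgD hp
    have hext := hD.frontier_subset_closure_exterior
    have hhD : ∀ y ∉ D, h y = 0 := by
      intro y hy
      have hy' : y ∈ closure (closure D)ᶜ := by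
        by_cases hyc : y ∈ closure D
        · exact hext (hD.1.frontier_eq ▸ ⟨hyc, hy⟩)
        · exact subset_closure hyc
      simp only [hh, hg0 y hy', zero_apply]
    set H := 16 * M / (1 - α / 2) * ε ^ (-1 + α / 2) with hHdef
    have hH : ∀ y, |h y| ≤ H := by
      intro y
      by_cases hy : y ∈ D
      · have := abs_le_of_norm_fderiv_le_rpow hD.1 hne hhd (fun p hp => ⟨hhD p ?_, ?_⟩) hε hM
          (e := -2 + α / 2) ⟨by linarith, by linarith⟩
          (fun y hy w hw hwy => (norm_fderiv_fderiv_apply_le hg hv y).trans (b2 y hy w hw hwy)) hy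
        · convert this using 3 <;> ring
        · rw [hD.1.frontier_eq] at hp
          exact hp.2
        · exact fderiv_eq_zero_of_mem_closure_exterior (hhC.of_le (by norm_num)) hhD (hext hp)
      · rw [hhD y hy, abs_zero]
        positivity
    have near : ∀ z, ‖z‖ < ρ → |h (x + z) - h x - fderiv ℝ h x z|
        ≤ M * ρ ^ (-3 + α / 2) * ‖z‖ ^ 2 := fun z hz =>
      norm_taylor_one_remainder_le hhC (fun y hy => by
        rw [mem_ball] at hy
        refine (norm_fderiv_fderiv_fderiv_apply_le hg hv y).trans
          (b3 y (ball_infDist_frontier_subset hD.1 hx ?_) ρ hρ (le_max_of_le_left ?_))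
        · rw [mem_ball]
          linarith
        · have := infDist_le_infDist_add_dist (s := F) (x := x) (y := y)
          rw [dist_comm] at this
          linarith) hz
    have far : ∀ z, ρ ≤ ‖z‖ → |h (x + z) - h x - fderiv ℝ h x z|
        ≤ M * ρ ^ (-2 + α / 2) * ‖z‖ + 2 * H := fun z _ => by
      have h1 : |fderiv ℝ h x z| ≤ M * ρ ^ (-2 + α / 2) * ‖z‖ :=
        (fderiv ℝ h x).le_of_opNorm_le ((norm_fderiv_fderiv_apply_le hg hv x).trans
          (b2 x hx ρ hρ (le_max_of_le_left (by linarith)))) z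
      have h2 := abs_sub (h (x + z) - h x) (fderiv ℝ h x z)
      have h3 := abs_sub (h (x + z)) (h x)
      linarith [hH x, hH (x + z)]
    refine (key ρ _ _ _ hρ (by positivity) near far).trans ?_
    set P := ε ^ (1 - α) * δ ^ (-2 + α / 2) with hP
    set Q := ε ^ (-1 + α / 2) * δ ^ (-α) with hQ
    have hP0 : 0 ≤ P := by positivity
    have hQ0 : 0 ≤ Q := by positivity
    have scale : ∀ q : ℝ, -2 ≤ q → ρ ^ q ≤ 16 * δ ^ q := fun q hq => by
      have h4 : (4 : ℝ) ^ (-q) ≤ 4 ^ (2 : ℝ) :=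
        Real.rpow_le_rpow_of_exponent_le (by norm_num) (by linarith)
      rw [hρdef, Real.div_rpow hδ0.le (by norm_num), div_eq_mul_inv, ← Real.rpow_neg (by norm_num),
        mul_comm]
      exact mul_le_mul_of_nonneg_right (h4.trans_eq (by norm_num)) (by positivity)
    have hρP : ρ ^ (1 - α) * ρ ^ (-2 + α / 2) ≤ 16 * P := by
      have h1 : ρ ^ (1 - α) ≤ ε ^ (1 - α) := Real.rpow_le_rpow_of_nonpos hε hερ (by linarith)
      calc _ ≤ ε ^ (1 - α) * (16 * δ ^ (-2 + α / 2)) :=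
            mul_le_mul h1 (scale _ (by linarith)) (by positivity) (by positivity)
        _ = 16 * P := by rw [hP]; ring
    have e1 : ρ ^ (-3 + α / 2) * ρ ^ (2 - α) ≤ 16 * P := by
      refine le_of_eq_of_le ?_ hρP
      rw [← Real.rpow_add hρ, ← Real.rpow_add hρ]
      congr 1; ring
    have e2 : ρ ^ (-2 + α / 2) * ρ ^ (-(α - 1)) ≤ 16 * P := by
      refine le_of_eq_of_le ?_ hρP
      rw [neg_sub, mul_comm]
    have e3 : ε ^ (-1 + α / 2) * ρ ^ (-α) ≤ 16 * Q := by
      calc _ ≤ ε ^ (-1 + α / 2) * (16 * δ ^ (-α)) :=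
            mul_le_mul_of_nonneg_left (scale _ (by linarith)) (by positivity)
        _ = 16 * Q := by rw [hQ]; ring
    calc _ = Λ * m * M * ((ρ ^ (-3 + α / 2) * ρ ^ (2 - α)) / (2 - α)
            + (ρ ^ (-2 + α / 2) * ρ ^ (-(α - 1))) / (α - 1)
            + 32 * (ε ^ (-1 + α / 2) * ρ ^ (-α)) / ((1 - α / 2) * α)) := by
          rw [hHdef]; field_simp; ring
      _ ≤ Λ * m * M * ((16 * P) / (2 - α) + (16 * P) / (α - 1)
            + 32 * (16 * Q) / ((1 - α / 2) * α)) := by gcongr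
      _ ≤ Λ * m * M * (16 / (2 - α) * (P + Q) + 16 / (α - 1) * (P + Q)
            + 512 / ((1 - α / 2) * α) * (P + Q)) := by
          refine mul_le_mul_of_nonneg_left ?_ (by positivity)
          have n1 : 0 ≤ 16 / (2 - α) * Q := by positivity
          have n2 : 0 ≤ 16 / (α - 1) * Q := by positivity
          have n3 : 0 ≤ 512 / ((1 - α / 2) * α) * P := by positivity
          have q1 : 16 * P / (2 - α) = 16 / (2 - α) * P := by ring
          have q2 : 16 * P / (α - 1) = 16 / (α - 1) * P := by ring
          have q3 : 32 * (16 * Q) / ((1 - α / 2) * α) = 512 / ((1 - α / 2) * α) * Q := by ring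
          rw [q1, q2, q3]
          linarith
      _ ≤ _ := by linarith
  · intro _
    have near : ∀ z, ‖z‖ < ε → |h (x + z) - h x - fderiv ℝ h x z|
        ≤ M * ε ^ (-3 + α / 2) * ‖z‖ ^ 2 := fun z hz =>
      norm_taylor_one_remainder_le hhC (fun y _ => G3 y) hz
    have far : ∀ z, ε ≤ ‖z‖ → |h (x + z) - h x - fderiv ℝ h x z|
        ≤ 2 * (M * ε ^ (-2 + α / 2)) * ‖z‖ + 0 := fun z _ => by
      have h1 : |fderiv ℝ h x z| ≤ M * ε ^ (-2 + α / 2) * ‖z‖ :=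
        (fderiv ℝ h x).le_of_opNorm_le (G2 x) z
      have h2 := abs_sub (h (x + z) - h x) (fderiv ℝ h x z)
      have h3 : |h (x + z) - h x| ≤ M * ε ^ (-2 + α / 2) * ‖z‖ := by
        simpa using convex_univ.norm_image_sub_le_of_norm_fderiv_le (fun y _ => hhd y)
          (fun y _ => G2 y) (mem_univ x) (mem_univ (x + z))
      linarith
    refine (key ε _ _ _ hε (by positivity) near far).trans ?_
    have e1 : ε ^ (-3 + α / 2) * ε ^ (2 - α) = ε ^ (-1 - α / 2) := by
      rw [← Real.rpow_add hε]
      congr 1; ring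
    have e2 : ε ^ (-2 + α / 2) * ε ^ (-(α - 1)) = ε ^ (-1 - α / 2) := by
      rw [← Real.rpow_add hε]
      congr 1; ring
    set R := ε ^ (-1 - α / 2) with hR
    have hR0 : 0 ≤ R := by positivity
    calc _ = Λ * m * M * ((ε ^ (-3 + α / 2) * ε ^ (2 - α)) / (2 - α)
            + 2 * (ε ^ (-2 + α / 2) * ε ^ (-(α - 1))) / (α - 1)) := by ring
      _ = Λ * m * M * (1 / (2 - α) + 2 / (α - 1)) * R := by rw [e1, e2]; ring
      _ ≤ _ := by
          refine mul_le_mul_of_nonneg_right ?_ hR0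
          have n3 : 0 ≤ 512 / ((1 - α / 2) * α) := by positivity
          have : 1 / (2 - α) + 2 / (α - 1)
              ≤ 16 / (2 - α) + 16 / (α - 1) + 512 / ((1 - α / 2) * α) := by
            have n1 : 1 / (2 - α) ≤ 16 / (2 - α) := by gcongr; norm_num
            have n2 : 2 / (α - 1) ≤ 16 / (α - 1) := by gcongr; norm_num
            linarith
          linarith [mul_le_mul_of_nonneg_left this (show 0 ≤ Λ * m * M by positivity)]
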